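/- Existence, uniqueness and holomorphy of the solution of the Gelfand–Levitan-type integral equation: for every x > 0 and every w with Re w > 0, the integral equation A(x,y,w) + ∫₀^x A(x,s,w)·Φ(s,y,w) ds + Φ(x,y,w) = 0 has a unique solution y ↦ A(x,y,w) in L²([0,x]) (the equation holding for almost every y ∈ [0,x]); moreover the map w ↦ A(x,·,w), from W = {Re z > 0} to L²([0,x]), is holomorphic. -/

import Mathlib

open MeasureTheory Set

noncomputable section

/-- The kernel `Φ(x,y,w) = ∫₀^∞ (sin kx / k)(sin ky / k)(√(k²+w) − k)(2k/π) dk`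
(principal branch of the complex square root). -/
def Phi (x y : ℝ) (w : ℂ) : ℂ :=
  ∫ k in Ioi (0:ℝ),
    ((Real.sin (k * x) / k : ℝ) : ℂ) * ((Real.sin (k * y) / k : ℝ) : ℂ) *
      (((k : ℂ) ^ 2 + w) ^ ((1 : ℂ) / 2) - (k : ℂ)) * ((2 * k / Real.pi : ℝ) : ℂ)


/-- The scalar multiplier. -/
def mult (k : ℝ) (w : ℂ) : ℂ :=
  (((k : ℂ) ^ 2 + w) ^ ((1 : ℂ) / 2) - (k : ℂ)) * ((2 / (Real.pi * k) : ℝ) : ℂ)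

lemma half_re {k : ℝ} (hk : 0 < k) {w : ℂ} (hw : 0 < w.re) :
    k ≤ ((((k : ℂ) ^ 2 + w) ^ ((1 : ℂ) / 2))).re := by
  have hre : ((k : ℂ) ^ 2 + w).re = k ^ 2 + w.re := by
    rw [← Complex.ofReal_pow, Complex.add_re, Complex.ofReal_re]
  rw [one_div, Complex.cpow_inv_two_re]
  apply Real.le_sqrt_of_sq_le
  have := Complex.re_le_norm ((k : ℂ) ^ 2 + w)
  rw [hre] at this ⊢
  linarith

lemma half_sq (z : ℂ) : (z ^ ((1 : ℂ) / 2)) ^ 2 = z := by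
  rw [one_div]
  exact_mod_cast Complex.cpow_nat_inv_pow z (n := 2) (by norm_num)

lemma slit {k : ℝ} {w : ℂ} (hw : 0 < w.re) : (k : ℂ) ^ 2 + w ∈ Complex.slitPlane := by
  left
  rw [← Complex.ofReal_pow]
  simp only [Complex.add_re, Complex.ofReal_re]
  positivity

lemma inv_pi_bound {k : ℝ} (hk : 0 < k) : ‖((2 / (Real.pi * k) : ℝ) : ℂ)‖ ≤ 1 / k := by
  rw [Complex.norm_real, Real.norm_of_nonneg (by positivity)]
  rw [div_le_div_iff₀ (by positivity) hk]
  nlinarith [Real.pi_gt_three]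

lemma mult_bound {k : ℝ} (hk : 0 < k) {w : ℂ} (hw : 0 < w.re) :
    ‖mult k w‖ ≤ ‖w‖ / k ^ 2 := by
  unfold mult
  set r := ((k : ℂ) ^ 2 + w) ^ ((1 : ℂ) / 2) with hr
  have h1 : k ≤ r.re := half_re hk hw
  have h2 : r ^ 2 = (k : ℂ) ^ 2 + w := half_sq _
  have h3 : (r - k) * (r + k) = w := by linear_combination h2
  have h4 : k ≤ ‖r + k‖ := by
    have := Complex.re_le_norm (r + k)
    simp at this
    linarith
  have h5 : ‖r - k‖ * k ≤ ‖w‖ := by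
    rw [← h3, norm_mul]; gcongr
  have h6 : ‖r - k‖ ≤ ‖w‖ / k := by rwa [le_div_iff₀ hk]
  rw [norm_mul]
  calc _ ≤ ‖w‖ / k * (1 / k) := by gcongr; exact inv_pi_bound hk
    _ = _ := by field_simp

lemma mult_re {k : ℝ} (hk : 0 < k) {w : ℂ} (hw : 0 < w.re) : 0 ≤ (mult k w).re := by
  unfold mult
  rw [Complex.re_mul_ofReal]
  have := half_re hk hw
  apply mul_nonneg _ (by positivity)
  simp only [Complex.sub_re, Complex.ofReal_re]; linarith

/-- Its derivative in `w`. -/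
def multD (k : ℝ) (w : ℂ) : ℂ :=
  (((1 : ℂ) / 2) * ((k : ℂ) ^ 2 + w) ^ ((1 : ℂ) / 2 - 1)) * ((2 / (Real.pi * k) : ℝ) : ℂ)

lemma mult_deriv {k : ℝ} {w : ℂ} (hw : 0 < w.re) :
    HasDerivAt (fun w => mult k w) (multD k w) w := by
  unfold mult multD
  have h : HasDerivAt (fun w : ℂ => (k : ℂ) ^ 2 + w) 1 w := (hasDerivAt_id w).const_add _
  have := h.cpow_const (c := (1 : ℂ) / 2) (slit hw)
  simpa using (this.sub_const (k : ℂ)).mul_const ((2 / (Real.pi * k) : ℝ) : ℂ)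

lemma multD_bound {k : ℝ} (hk : 0 < k) {w : ℂ} (hw : 0 < w.re) :
    ‖multD k w‖ ≤ 1 / k ^ 2 := by
  unfold multD
  have hne : (k : ℂ) ^ 2 + w ≠ 0 := Complex.slitPlane_ne_zero (slit hw)
  have h1 := half_re hk hw
  set r := ((k : ℂ) ^ 2 + w) ^ ((1 : ℂ) / 2) with hr
  have h2 : r ^ 2 = (k : ℂ) ^ 2 + w := half_sq _
  have h3 : ((k : ℂ) ^ 2 + w) ^ ((1 : ℂ) / 2 - 1) = r⁻¹ := by
    rw [Complex.cpow_sub _ _ hne, Complex.cpow_one, ← hr, ← h2]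
    have : r ≠ 0 := by
      intro h; rw [h] at h1; simp at h1; linarith
    field_simp
  have h4 : k ≤ ‖r‖ := h1.trans (Complex.re_le_norm r)
  rw [h3, norm_mul, norm_mul, norm_inv]
  have h5 : ‖((1 : ℂ) / 2)‖ ≤ 1 := by norm_num
  have h6 : ‖r‖⁻¹ ≤ k⁻¹ := by gcongr
  calc _ ≤ 1 * k⁻¹ * (1 / k) := by gcongr; exact inv_pi_bound hk
    _ = _ := by field_simp

lemma mult_cont {w : ℂ} (hw : 0 < w.re) : ContinuousOn (fun k => mult k w) (Ioi 0) := by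
  unfold mult
  intro k hk
  have hk' : Real.pi * k ≠ 0 := mul_ne_zero Real.pi_ne_zero (ne_of_gt hk)
  apply ContinuousAt.continuousWithinAt
  apply ContinuousAt.mul
  · refine ContinuousAt.sub (ContinuousAt.cpow (by fun_prop) (by fun_prop) (slit hw)) (by fun_prop)
  · apply Complex.continuous_ofReal.continuousAt.comp
    exact ContinuousAt.div (by fun_prop) (by fun_prop) hk'

lemma multD_cont {w : ℂ} (hw : 0 < w.re) : ContinuousOn (fun k => multD k w) (Ioi 0) := by
  unfold multD
  intro k hk
  have hk' : Real.pi * k ≠ 0 := mul_ne_zero Real.pi_ne_zero (ne_of_gt hk)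
  apply ContinuousAt.continuousWithinAt
  apply ContinuousAt.mul
  · refine ContinuousAt.mul (by fun_prop) (ContinuousAt.cpow (by fun_prop) (by fun_prop) (slit hw))
  · apply Complex.continuous_ofReal.continuousAt.comp
    exact ContinuousAt.div (by fun_prop) (by fun_prop) hk'

section general
variable {E : Type*} [NormedAddCommGroup E] [NormedSpace ℂ E]

lemma gen_integrable {F : ℝ → E} (hF : Continuous F) {C : ℝ}
    (hC : ∀ k, 0 < k → ‖F k‖ ≤ C * (k ^ 2 * (1 + k ^ 2)⁻¹)) {w : ℂ} (hw : 0 < w.re) :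
    Integrable (fun k => mult k w • F k) (volume.restrict (Ioi 0)) := by
  have hb : IntegrableOn (fun k : ℝ => ‖w‖ * C * (1 + k ^ 2)⁻¹) (Ioi 0) :=
    (integrable_inv_one_add_sq.const_mul _).integrableOn
  refine Integrable.mono' hb
    (((mult_cont hw).smul hF.continuousOn).aestronglyMeasurable measurableSet_Ioi) ?_
  filter_upwards [ae_restrict_mem measurableSet_Ioi] with k hk
  have hk : 0 < k := hk
  rw [norm_smul]
  calc _ ≤ (‖w‖ / k ^ 2) * (C * (k ^ 2 * (1 + k ^ 2)⁻¹)) := by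
        gcongr
        · exact mult_bound hk hw
        · exact hC k hk
    _ = _ := by field_simp

lemma gen_differentiable {F : ℝ → E} (hF : Continuous F) {C : ℝ}
    (hC : ∀ k, 0 < k → ‖F k‖ ≤ C * (k ^ 2 * (1 + k ^ 2)⁻¹)) {w : ℂ} (hw : 0 < w.re) :
    DifferentiableAt ℂ (fun w => ∫ k in Ioi (0 : ℝ), mult k w • F k) w := by
  have hopen : {w : ℂ | 0 < w.re} ∈ nhds w :=
    (isOpen_lt continuous_const Complex.continuous_re).mem_nhds hw
  have hb : IntegrableOn (fun k : ℝ => C * (1 + k ^ 2)⁻¹) (Ioi 0) :=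
    (integrable_inv_one_add_sq.const_mul _).integrableOn
  refine (hasDerivAt_integral_of_dominated_loc_of_deriv_le
    (F' := fun w k => multD k w • F k) hopen ?_ (gen_integrable hF hC hw) ?_ ?_ hb
    ?_).2.differentiableAt
  · filter_upwards [hopen] with v hv
    exact (gen_integrable hF hC hv).aestronglyMeasurable
  · exact ((multD_cont hw).smul hF.continuousOn).aestronglyMeasurable measurableSet_Ioi
  · filter_upwards [ae_restrict_mem measurableSet_Ioi] with k hk v hv
    have hk : 0 < k := hk
    rw [norm_smul]
    calc _ ≤ (1 / k ^ 2) * (C * (k ^ 2 * (1 + k ^ 2)⁻¹)) := by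
          gcongr
          · exact multD_bound hk hv
          · exact hC k hk
      _ = _ := by field_simp
  · filter_upwards with k v hv
    exact (mult_deriv hv).smul_const _

end general

open BoundedContinuousFunction in
/-- `y ↦ sin (k y)`, with `y` clamped to `[0,x]`. -/
def sinB (x : ℝ) (k : ℝ) : BoundedContinuousFunction ℝ ℂ :=
  BoundedContinuousFunction.ofNormedAddCommGroup
    (fun y => ((Real.sin (k * max 0 (min x y)) : ℝ) : ℂ)) (by fun_prop) 1 (by
      intro y
      rw [Complex.norm_real]
      exact Real.abs_sin_le_one _)

lemma sinB_apply (x k y : ℝ) : sinB x k y = ((Real.sin (k * max 0 (min x y)) : ℝ) : ℂ) := rfl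

lemma sinB_apply' {x k y : ℝ} (hy : y ∈ Icc 0 x) : sinB x k y = ((Real.sin (k * y) : ℝ) : ℂ) := by
  rw [sinB_apply, min_eq_right hy.2, max_eq_right hy.1]

lemma abs_sin_sub_le (a b : ℝ) : |Real.sin a - Real.sin b| ≤ |a - b| := by
  have := Real.lipschitzWith_sin.dist_le_mul a b
  simpa [Real.dist_eq] using this

lemma clamp_abs {x : ℝ} (hx : 0 < x) (y : ℝ) : |max 0 (min x y)| ≤ x := by
  rw [abs_of_nonneg (le_max_left _ _)]
  exact max_le hx.le (min_le_left _ _)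

lemma sinB_cont {x : ℝ} (hx : 0 < x) : Continuous (sinB x) := by
  have : LipschitzWith x.toNNReal (sinB x) := by
    refine LipschitzWith.of_dist_le_mul fun a b => ?_
    rw [BoundedContinuousFunction.dist_le (by positivity)]
    intro y
    rw [sinB_apply, sinB_apply, dist_eq_norm, ← Complex.ofReal_sub, Complex.norm_real,
      Real.norm_eq_abs, Real.coe_toNNReal _ hx.le, Real.dist_eq]
    refine (abs_sin_sub_le _ _).trans ?_
    rw [← sub_mul, abs_mul, mul_comm]
    gcongr
    exact clamp_abs hx y
  exact this.continuous

lemma sinB_norm_one (x k : ℝ) : ‖sinB x k‖ ≤ 1 :=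
  BoundedContinuousFunction.norm_ofNormedAddCommGroup_le _ zero_le_one _

lemma sinB_norm_two {x k : ℝ} (hx : 0 < x) (hk : 0 < k) : ‖sinB x k‖ ≤ k * x := by
  rw [BoundedContinuousFunction.norm_le (by positivity)]
  intro y
  rw [sinB_apply, Complex.norm_real, Real.norm_eq_abs]
  have := abs_sin_sub_le (k * max 0 (min x y)) 0
  simp only [Real.sin_zero, sub_zero] at this
  refine this.trans ?_
  rw [abs_mul, abs_of_pos hk]
  gcongr
  exact clamp_abs hx y

lemma sinB_sq {x k : ℝ} (hx : 0 < x) (hk : 0 < k) :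
    ‖sinB x k‖ * ‖sinB x k‖ ≤ (1 + x ^ 2) * (k ^ 2 * (1 + k ^ 2)⁻¹) := by
  have h1 := sinB_norm_one x k
  have h2 := sinB_norm_two hx hk
  have h0 := norm_nonneg (sinB x k)
  rw [← mul_assoc, ← div_eq_mul_inv, le_div_iff₀ (by positivity)]
  have h3 : ‖sinB x k‖ * ‖sinB x k‖ ≤ (k * x) * (k * x) := by gcongr
  have h4 : ‖sinB x k‖ * ‖sinB x k‖ ≤ 1 * 1 := by gcongr
  nlinarith [sq_nonneg k]

section aux
variable (x : ℝ)

/-- The Hilbert space. -/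
abbrev HH (x : ℝ) := Lp ℂ 2 (volume.restrict (Icc (0:ℝ) x))

/-- Inclusion of bounded continuous functions. -/
def incl (x : ℝ) : BoundedContinuousFunction ℝ ℂ →L[ℂ] HH x :=
  BoundedContinuousFunction.toLp 2 (volume.restrict (Icc (0:ℝ) x)) ℂ

lemma incl_ae (f : BoundedContinuousFunction ℝ ℂ) :
    incl x f =ᵐ[volume.restrict (Icc (0:ℝ) x)] f :=
  BoundedContinuousFunction.coeFn_toLp 2 _ ℂ f

/-- Pairing with `h`: `f ↦ ∫ h f`. -/
def pair (h : HH x) : BoundedContinuousFunction ℝ ℂ →L[ℂ] ℂ :=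
  (innerSL ℂ (star h)).comp (incl x)

lemma pair_apply (h : HH x) (f : BoundedContinuousFunction ℝ ℂ) :
    pair x h f = ∫ s in Icc (0:ℝ) x, h s * f s := by
  unfold pair
  simp only [ContinuousLinearMap.comp_apply, innerSL_apply_apply]
  rw [L2.inner_def]
  apply integral_congr_ae
  filter_upwards [incl_ae x f, Lp.coeFn_star h] with s h1 h2
  rw [h1, h2]
  simp [mul_comm]

lemma pair_sin (h : HH x) (k : ℝ) : pair x h (sinB x k) = inner ℂ (incl x (sinB x k)) h := by
  rw [pair_apply, L2.inner_def]
  apply integral_congr_ae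
  filter_upwards [incl_ae x (sinB x k)] with s h1
  rw [h1, sinB_apply]
  simp [-Complex.ofReal_sin, mul_comm]

/-- Rank one operators. -/
def rk (k : ℝ) : HH x →L[ℂ] BoundedContinuousFunction ℝ ℂ :=
  ContinuousLinearMap.smulRight (innerSL ℂ (incl x (sinB x k))) (sinB x k)

lemma rk_apply (k : ℝ) (h : HH x) : rk x k h = pair x h (sinB x k) • sinB x k := by
  rw [pair_sin]; rfl

variable {x}

lemma rk_cont (hx : 0 < x) : Continuous (rk x) := by
  have h1 : Continuous fun k => innerSL ℂ (incl x (sinB x k)) :=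
    (innerSL ℂ).continuous.comp ((incl x).continuous.comp (sinB_cont hx))
  have h2 := sinB_cont hx
  have : rk x = fun k => ContinuousLinearMap.smulRightL ℂ (HH x) (BoundedContinuousFunction ℝ ℂ)
    (innerSL ℂ (incl x (sinB x k))) (sinB x k) := rfl
  rw [this]
  fun_prop

lemma rk_bound (hx : 0 < x) (k : ℝ) (hk : 0 < k) :
    ‖rk x k‖ ≤ (‖incl x‖ * (1 + x ^ 2)) * (k ^ 2 * (1 + k ^ 2)⁻¹) := by
  unfold rk
  rw [ContinuousLinearMap.norm_smulRight_apply, innerSL_apply_norm]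
  calc _ ≤ ‖incl x‖ * ‖sinB x k‖ * ‖sinB x k‖ := by gcongr; exact (incl x).le_opNorm _
    _ ≤ ‖incl x‖ * ((1 + x ^ 2) * (k ^ 2 * (1 + k ^ 2)⁻¹)) := by
        rw [mul_assoc]; exact mul_le_mul_of_nonneg_left (sinB_sq hx hk) (norm_nonneg _)
    _ = _ := by ring

/-- Integrand for `Φ(·,y)`. -/
def ss (x y k : ℝ) : BoundedContinuousFunction ℝ ℂ := sinB x k y • sinB x k

lemma ss_cont (hx : 0 < x) (y : ℝ) : Continuous (ss x y) := by
  have h := sinB_cont hx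
  have : Continuous fun k => sinB x k y :=
    (BoundedContinuousFunction.evalCLM ℂ y).continuous.comp h
  exact this.smul h

lemma ss_bound (hx : 0 < x) (y k : ℝ) (hk : 0 < k) :
    ‖ss x y k‖ ≤ (1 + x ^ 2) * (k ^ 2 * (1 + k ^ 2)⁻¹) := by
  refine le_trans ?_ (sinB_sq hx hk)
  unfold ss
  rw [norm_smul]
  gcongr
  exact (sinB x k).norm_coe_le_norm y

/-- `Φ(·,y)` as a bounded continuous function. -/
def PhiB (x y : ℝ) (w : ℂ) : BoundedContinuousFunction ℝ ℂ :=
  ∫ k in Ioi (0:ℝ), mult k w • ss x y k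

lemma PhiB_apply (hx : 0 < x) {y s : ℝ} (hy : y ∈ Icc 0 x) (hs : s ∈ Icc 0 x) {w : ℂ}
    (hw : 0 < w.re) : PhiB x y w s = Phi s y w := by
  have h := (BoundedContinuousFunction.evalCLM ℂ s).integral_comp_comm
    (gen_integrable (ss_cont hx y) (ss_bound hx y) hw)
  change _ = PhiB x y w s at h
  rw [← h]
  unfold Phi
  apply setIntegral_congr_fun measurableSet_Ioi
  intro k hk
  have hk : (k : ℂ) ≠ 0 := by exact_mod_cast (ne_of_gt hk : k ≠ 0)
  have hpi : (Real.pi : ℂ) ≠ 0 := by exact_mod_cast Real.pi_ne_zero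
  simp only [BoundedContinuousFunction.evalCLM_apply, ss, BoundedContinuousFunction.coe_smul,
    sinB_apply' hy, sinB_apply' hs, smul_eq_mul, mult]
  push_cast
  field_simp

lemma Phi_symm (s y : ℝ) (w : ℂ) : Phi s y w = Phi y s w := by
  unfold Phi
  congr 1
  ext k
  ring

/-- The operator, into bounded continuous functions. -/
def KB (x : ℝ) (w : ℂ) : HH x →L[ℂ] BoundedContinuousFunction ℝ ℂ :=
  ∫ k in Ioi (0:ℝ), mult k w • rk x k

/-- The operator on `L²`. -/
def KK (x : ℝ) (w : ℂ) : HH x →L[ℂ] HH x := (incl x).comp (KB x w)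

lemma KB_apply (hx : 0 < x) {w : ℂ} (hw : 0 < w.re) (h : HH x) :
    KB x w h = ∫ k in Ioi (0:ℝ), mult k w • (pair x h (sinB x k) • sinB x k) := by
  unfold KB
  rw [ContinuousLinearMap.integral_apply (gen_integrable (E := HH x →L[ℂ] BoundedContinuousFunction ℝ ℂ) (F := rk x) (rk_cont hx) (rk_bound hx) hw)]
  simp only [ContinuousLinearMap.smul_apply, rk_apply]

lemma KB_int (hx : 0 < x) {w : ℂ} (hw : 0 < w.re) (h : HH x) :
    Integrable (fun k => mult k w • (pair x h (sinB x k) • sinB x k))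
      (volume.restrict (Ioi 0)) := by
  have := (gen_integrable (E := HH x →L[ℂ] BoundedContinuousFunction ℝ ℂ) (F := rk x) (rk_cont hx) (rk_bound hx) hw).apply_continuousLinearMap h
  simpa only [ContinuousLinearMap.smul_apply, rk_apply] using this

lemma KB_apply_eq (hx : 0 < x) {w : ℂ} (hw : 0 < w.re) (h : HH x) {y : ℝ} (hy : y ∈ Icc 0 x) :
    KB x w h y = ∫ s in (0:ℝ)..x, h s * Phi s y w := by
  have e1 : ∫ s in (0:ℝ)..x, h s * Phi s y w = pair x h (PhiB x y w) := by
    rw [pair_apply, intervalIntegral.integral_of_le hx.le, ← integral_Icc_eq_integral_Ioc]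
    apply setIntegral_congr_fun measurableSet_Icc
    intro s hs
    simp only [PhiB_apply hx hy hs hw]
  rw [e1, KB_apply hx hw]
  unfold PhiB
  rw [← (pair x h).integral_comp_comm (gen_integrable (ss_cont hx y) (ss_bound hx y) hw)]
  have := (BoundedContinuousFunction.evalCLM ℂ y).integral_comp_comm (KB_int hx hw h)
  rw [BoundedContinuousFunction.evalCLM_apply] at this
  rw [← this]
  congr 1
  ext k
  simp only [BoundedContinuousFunction.evalCLM_apply, ss, BoundedContinuousFunction.coe_smul,
    map_smul, smul_eq_mul]
  ring

lemma KK_re (hx : 0 < x) {w : ℂ} (hw : 0 < w.re) (h : HH x) :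
    0 ≤ (inner ℂ h (KK x w h)).re := by
  have e1 : inner ℂ h (KK x w h) = ((innerSL ℂ h).comp (incl x)) (KB x w h) := rfl
  rw [e1, KB_apply hx hw, ← ContinuousLinearMap.integral_comp_comm _ (KB_int hx hw h)]
  have hi := ((innerSL ℂ h).comp (incl x)).integrable_comp (KB_int hx hw h)
  have := Complex.reCLM.integral_comp_comm hi
  simp only [Complex.reCLM_apply] at this
  rw [← this]
  apply setIntegral_nonneg measurableSet_Ioi
  intro k hk
  simp only [map_smul, ContinuousLinearMap.comp_apply, innerSL_apply_apply, smul_eq_mul, pair_sin]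
  rw [← inner_conj_symm h, Complex.mul_conj, Complex.re_mul_ofReal]
  exact mul_nonneg (mult_re hk hw) (Complex.normSq_nonneg _)

lemma KK_unit (hx : 0 < x) {w : ℂ} (hw : 0 < w.re) : IsUnit (1 + KK x w) := by
  apply ContinuousLinearMap.isUnit_of_forall_le_norm_inner_map _ (c := 1) one_pos
  intro h
  rw [norm_inner_symm]
  refine le_trans ?_ (Complex.re_le_norm _)
  have := KK_re hx hw h
  rw [ContinuousLinearMap.add_apply, inner_add_right, Complex.add_re]
  have h2 : (inner ℂ h ((1 : HH x →L[ℂ] HH x) h)).re = ‖h‖ ^ 2 := by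
    have := inner_self_eq_norm_sq (𝕜 := ℂ) h
    simpa using this
  rw [h2]; simpa using this

lemma KK_diff (hx : 0 < x) {w : ℂ} (hw : 0 < w.re) : DifferentiableAt ℂ (KK x) w := by
  have := gen_differentiable (E := HH x →L[ℂ] BoundedContinuousFunction ℝ ℂ) (F := rk x) (rk_cont hx) (rk_bound hx) hw
  have h2 := (ContinuousLinearMap.compL ℂ (HH x) (BoundedContinuousFunction ℝ ℂ) (HH x)
    (incl x)).differentiableAt (x := KB x w)
  exact h2.comp w this

lemma eqn_iff (hx : 0 < x) {w : ℂ} (hw : 0 < w.re) (g : HH x) :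
    (∀ᵐ y ∂(volume.restrict (Icc (0:ℝ) x)),
          g y + (∫ s in (0:ℝ)..x, g s * Phi s y w) + Phi x y w = 0) ↔
      (1 + KK x w) g = - incl x (PhiB x x w) := by
  rw [← add_eq_zero_iff_eq_neg, Lp.eq_zero_iff_ae_eq_zero]
  have hxx : x ∈ Icc 0 x := ⟨hx.le, le_rfl⟩
  have key : ∀ᵐ y ∂(volume.restrict (Icc (0:ℝ) x)),
      ((1 + KK x w) g + incl x (PhiB x x w) : HH x) y =
        g y + (∫ s in (0:ℝ)..x, g s * Phi s y w) + Phi x y w := by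
    have e : ((1 + KK x w) g : HH x) = g + incl x (KB x w g) := rfl
    rw [e]
    filter_upwards [Lp.coeFn_add (g + incl x (KB x w g)) (incl x (PhiB x x w)),
      Lp.coeFn_add g (incl x (KB x w g)), incl_ae x (KB x w g), incl_ae x (PhiB x x w),
      ae_restrict_mem measurableSet_Icc] with y h1 h2 h3 h4 hy
    rw [h1, Pi.add_apply, h2, Pi.add_apply, h3, h4, KB_apply_eq hx hw g hy,
      PhiB_apply hx hxx hy hw, Phi_symm y x]
  constructor
  · intro h
    filter_upwards [h, key] with y h1 h2
    rw [h2, h1]; rfl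
  · intro h
    filter_upwards [h, key] with y h1 h2
    rw [← h2, h1]; rfl

end aux

/-- **Existence, uniqueness and holomorphy of the solution of the Gelfand–Levitan-type
integral equation.** For every `x > 0` and `Re w > 0`, the equation
`A(x,y,w) + ∫₀^x A(x,s,w)Φ(s,y,w) ds + Φ(x,y,w) = 0` has a unique solution
`y ↦ A(x,y,w)` in `L²([0,x])` (the equation holding for a.e. `y ∈ [0,x]`), and the map
`w ↦ A(x,·,w) ∈ L²([0,x])` is holomorphic on `{Re w > 0}`. -/
theorem stmt_13 (x : ℝ) (hx : 0 < x) :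
    ∃ 𝒜 : ℂ → Lp ℂ 2 (volume.restrict (Icc (0:ℝ) x)),
      (∀ w : ℂ, 0 < w.re →
        ∀ᵐ y ∂(volume.restrict (Icc (0:ℝ) x)),
          𝒜 w y + (∫ s in (0:ℝ)..x, 𝒜 w s * Phi s y w) + Phi x y w = 0) ∧
      (∀ w : ℂ, 0 < w.re → ∀ g : Lp ℂ 2 (volume.restrict (Icc (0:ℝ) x)),
        (∀ᵐ y ∂(volume.restrict (Icc (0:ℝ) x)),
          g y + (∫ s in (0:ℝ)..x, g s * Phi s y w) + Phi x y w = 0) →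
        g = 𝒜 w) ∧
      DifferentiableOn ℂ 𝒜 {w : ℂ | 0 < w.re} := by
  refine ⟨fun w => Ring.inverse (1 + KK x w) (- incl x (PhiB x x w)), ?_, ?_, ?_⟩
  · intro w hw
    rw [eqn_iff hx hw, ← ContinuousLinearMap.mul_apply, Ring.mul_inverse_cancel _ (KK_unit hx hw)]
    rfl
  · intro w hw g hg
    rw [eqn_iff hx hw] at hg
    change g = Ring.inverse (1 + KK x w) (- incl x (PhiB x x w))
    rw [← hg, ← ContinuousLinearMap.mul_apply, Ring.inverse_mul_cancel _ (KK_unit hx hw)]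
    rfl
  · intro w hw
    have hw : 0 < w.re := hw
    apply DifferentiableAt.differentiableWithinAt
    apply DifferentiableAt.clm_apply
    · exact (differentiableAt_inverse (𝕜 := ℂ) (KK_unit hx hw)).comp w
        ((differentiableAt_const _).add (KK_diff hx hw))
    · apply DifferentiableAt.neg
      exact (incl x).differentiableAt.comp w
        (gen_differentiable (ss_cont hx x) (ss_bound hx x) hw)

end
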